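/- Let S be a finite set, |S| = n, and let f : S → S have functional graph isomorphic to W_{m,t}: a directed cycle z₀ → z₁ → ... → z_{m−1} → z₀ together with t additional vertices each mapped by f to z₀ (so n = m + t). Then the number of functions g : S → S commuting with f equals m − 1 + (t+1)^t. -/

import Mathlib

theorem commuting_card_W_graph {S : Type*} [Fintype S]
    (m t : ℕ) (hm : 0 < m) (hcard : Fintype.card S = m + t)
    (f : S → S) (z : ZMod m → S) (hz : Function.Injective z)
    (hcyc : ∀ k : ZMod m, f (z k) = z (k + 1))
    (htree : ∀ y : S, y ∉ Set.range z → f y = z 0) :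
    Nat.card {g : S → S | f ∘ g = g ∘ f} = m - 1 + (t + 1) ^ t := by
  classical
  haveI : NeZero m := ⟨hm.ne'⟩
  obtain ⟨r, hr⟩ := hz.hasLeftInverse
  -- number of vertices off the cycle
  have hT : Fintype.card {y : S // y ∉ Set.range z} = t := by
    have h1 : Fintype.card {y : S // y ∈ Set.range z} = m := by
      rw [← Fintype.card_congr (Equiv.ofInjective z hz), ZMod.card]
    have h2 := Fintype.card_subtype_compl (fun y : S => y ∈ Set.range z)
    rw [h2, h1, hcard]; omega
  -- fibres
  have hF0 : Fintype.card {x : S // f x = z 0} = t + 1 := by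
    rw [← hT, Fintype.card_subtype, Fintype.card_subtype]
    have : (Finset.univ.filter fun x : S => f x = z 0)
        = insert (z (-1)) (Finset.univ.filter fun y : S => y ∉ Set.range z) := by
      ext x
      simp only [Finset.mem_filter, Finset.mem_univ, true_and, Finset.mem_insert]
      constructor
      · intro h
        by_cases hx : x ∈ Set.range z
        · obtain ⟨k, rfl⟩ := hx
          left
          rw [hcyc] at h
          rw [eq_neg_of_add_eq_zero_left (hz h)]
        · exact Or.inr hx
      · rintro (rfl | h)
        · rw [hcyc]; simp
        · exact htree x h
    rw [this, Finset.card_insert_of_notMem]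
    simp
  have hF1 : ∀ a : ZMod m, a ≠ 0 → Fintype.card {x : S // f x = z a} = 1 := by
    intro a ha
    rw [Fintype.card_eq_one_iff]
    refine ⟨⟨z (a - 1), by rw [hcyc]; simp⟩, ?_⟩
    rintro ⟨x, hx⟩
    apply Subtype.ext
    by_cases h : x ∈ Set.range z
    · obtain ⟨k, rfl⟩ := h
      rw [hcyc] at hx
      have := hz hx
      simp [← this]
    · rw [htree x h] at hx
      exact absurd (hz hx).symm ha
  have hfr : ∀ x, f x ∈ Set.range z := by
    intro x
    by_cases h : x ∈ Set.range z
    · obtain ⟨k, rfl⟩ := h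
      exact ⟨_, (hcyc k).symm⟩
    · exact ⟨0, (htree x h).symm⟩
  let G : (Σ a : ZMod m, ({y : S // y ∉ Set.range z} → {x : S // f x = z a})) → S → S :=
    fun p y => if hy : y ∈ Set.range z then z (r y + p.1) else (p.2 ⟨y, hy⟩).1
  have hGz : ∀ p k, G p (z k) = z (k + p.1) := by
    intro p k
    simp [G, hr k]
  have hGy : ∀ p y (hy : y ∉ Set.range z), G p y = (p.2 ⟨y, hy⟩).1 := by
    intro p y hy
    simp only [G]
    rw [dif_neg hy]
  have hG : ∀ p, G p ∈ {g : S → S | f ∘ g = g ∘ f} := by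
    intro p
    funext y
    simp only [Function.comp]
    by_cases hy : y ∈ Set.range z
    · obtain ⟨k, rfl⟩ := hy
      rw [hGz, hcyc, hcyc, hGz]; congr 1; ring
    · rw [hGy p y hy, htree y hy, hGz, (p.2 ⟨y, hy⟩).2]; simp
  have hbij : Function.Bijective (fun p => (⟨G p, hG p⟩ : {g : S → S | f ∘ g = g ∘ f})) := by
    constructor
    · rintro ⟨a, h⟩ ⟨b, h'⟩ e
      have e' : G ⟨a, h⟩ = G ⟨b, h'⟩ := congrArg Subtype.val e
      have hab : a = b := by
        have := congrFun e' (z 0)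
        rw [hGz, hGz] at this
        simpa using hz this
      subst hab
      congr 1
      funext y
      apply Subtype.ext
      have := congrFun e' y.1
      rwa [hGy _ _ y.2, hGy _ _ y.2] at this
    · rintro ⟨g, hg⟩
      have hg' : ∀ x, f (g x) = g (f x) := fun x => congrFun hg x
      obtain ⟨a, ha⟩ : g (z 0) ∈ Set.range z := by
        have : z 0 = f (z (-1)) := by rw [hcyc]; simp
        rw [this, ← hg']
        exact hfr _
      have hgn : ∀ n : ℕ, g (z n) = z (n + a) := by
        intro n
        induction n with
        | zero => simp [ha]
        | succ n ih =>
          rw [Nat.cast_succ, ← hcyc, ← hg', ih, hcyc]; congr 1; ring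
      refine ⟨⟨a, fun y => ⟨g y.1, by rw [hg', htree _ y.2, ha]⟩⟩, ?_⟩
      apply Subtype.ext
      funext y
      change G _ y = g y
      by_cases hy : y ∈ Set.range z
      · obtain ⟨k, rfl⟩ := hy
        rw [hGz]
        have := hgn k.val
        rw [ZMod.natCast_zmod_val] at this
        rw [this]
      · rw [hGy _ _ hy]
  rw [← Nat.card_congr (Equiv.ofBijective _ hbij), Nat.card_eq_fintype_card, Fintype.card_sigma]
  simp only [Fintype.card_fun, hT]
  rw [← Finset.sum_erase_add _ _ (Finset.mem_univ (0 : ZMod m)), hF0]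
  congr 1
  rw [Finset.sum_congr rfl (g := fun _ => 1)]
  · simp [Finset.card_erase_of_mem, ZMod.card]
  · intro a ha
    rw [hF1 a (Finset.ne_of_mem_erase ha), one_pow]
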